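/- arXiv:math/0702276 — 7 statements merged into one kernel-verified Lean document; each statement's English description precedes it below -/
import Mathlib

section
/- The map F(ξ,η) = (μ₁, μ₂) with μ₁ = −η + 1/ξ̄ and μ₂ = 1/(η̄ + 1/ξ) is a bijection from {(ξ,η) ∈ ℂ² : ξ ≠ 0 and ξη̄ + 1 ≠ 0} onto {(μ₁,μ₂) ∈ ℂ² : μ₂ ≠ 0 and μ̄₁μ₂ + 1 ≠ 0}, with inverse given by η = −(1/2)(μ₁ − 1/μ̄₂) and ξ = 2/(μ̄₁ + 1/μ₂). -/
open ComplexConjugate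

/-- The change of coordinates `(ξ,η) ↦ (μ₁,μ₂)` on the space of oriented geodesics. -/
noncomputable def Fmap (p : ℂ × ℂ) : ℂ × ℂ :=
  (-p.2 + 1 / conj p.1, 1 / (conj p.2 + 1 / p.1))

/-- The inverse change of coordinates `(μ₁,μ₂) ↦ (ξ,η)`. -/
noncomputable def Gmap (q : ℂ × ℂ) : ℂ × ℂ :=
  (2 / (conj q.1 + 1 / q.2), -(1 / 2) * (q.1 - 1 / conj q.2))

theorem Gmap_leftInverse_Fmap : Function.LeftInverse Gmap Fmap := by
  rintro ⟨x, y⟩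
  simp only [Fmap, Gmap, Prod.mk.injEq, map_add, map_neg, map_div₀, map_one, Complex.conj_conj,
    one_div_one_div]
  constructor
  · rw [show -conj y + 1 / x + (conj y + 1 / x) = 2 / x by ring, div_div_cancel₀ two_ne_zero]
  · ring

theorem Gmap_rightInverse_Fmap : Function.RightInverse Gmap Fmap := by
  rintro ⟨u, v⟩
  simp only [Fmap, Gmap, Prod.mk.injEq, map_add, map_sub, map_neg, map_mul, map_div₀, map_one,
    map_ofNat, Complex.conj_conj, one_div_div]
  constructor
  · ring
  · rw [show -(1 / 2) * (conj u - 1 / v) + (conj u + 1 / v) / 2 = 1 / v by ring, one_div_one_div]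

theorem mul_add_one_ne_zero_iff {x : ℂ} (hx : x ≠ 0) (y : ℂ) :
    x * y + 1 ≠ 0 ↔ y + 1 / x ≠ 0 := by
  rw [show x * y + 1 = x * (y + 1 / x) by field_simp, mul_ne_zero_iff, and_iff_right hx]

theorem mapsTo_Fmap :
    Set.MapsTo Fmap {p : ℂ × ℂ | p.1 ≠ 0 ∧ p.1 * conj p.2 + 1 ≠ 0}
      {q : ℂ × ℂ | q.2 ≠ 0 ∧ conj q.1 * q.2 + 1 ≠ 0} := by
  rintro ⟨x, y⟩ ⟨hx, hxy⟩
  have hv : (Fmap (x, y)).2 ≠ 0 := one_div_ne_zero ((mul_add_one_ne_zero_iff hx _).1 hxy)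
  refine ⟨hv, ?_⟩
  rw [mul_comm, mul_add_one_ne_zero_iff hv]
  have h : (Gmap (Fmap (x, y))).1 ≠ 0 := by rwa [Gmap_leftInverse_Fmap]
  exact (div_ne_zero_iff.1 h).2

theorem mapsTo_Gmap :
    Set.MapsTo Gmap {q : ℂ × ℂ | q.2 ≠ 0 ∧ conj q.1 * q.2 + 1 ≠ 0}
      {p : ℂ × ℂ | p.1 ≠ 0 ∧ p.1 * conj p.2 + 1 ≠ 0} := by
  rintro ⟨u, v⟩ ⟨hv, huv⟩
  rw [mul_comm, mul_add_one_ne_zero_iff hv] at huv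
  have hx : (Gmap (u, v)).1 ≠ 0 := div_ne_zero two_ne_zero huv
  refine ⟨hx, ?_⟩
  rw [mul_add_one_ne_zero_iff hx]
  have h : (Fmap (Gmap (u, v))).2 ≠ 0 := by rwa [Gmap_rightInverse_Fmap]
  exact (div_ne_zero_iff.1 h).2

theorem stmt_7 :
    Set.BijOn Fmap {p : ℂ × ℂ | p.1 ≠ 0 ∧ p.1 * conj p.2 + 1 ≠ 0}
      {q : ℂ × ℂ | q.2 ≠ 0 ∧ conj q.1 * q.2 + 1 ≠ 0} ∧
    Set.InvOn Gmap Fmap {p : ℂ × ℂ | p.1 ≠ 0 ∧ p.1 * conj p.2 + 1 ≠ 0}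
      {q : ℂ × ℂ | q.2 ≠ 0 ∧ conj q.1 * q.2 + 1 ≠ 0} := by
  have h : Set.InvOn Gmap Fmap {p : ℂ × ℂ | p.1 ≠ 0 ∧ p.1 * conj p.2 + 1 ≠ 0}
      {q : ℂ × ℂ | q.2 ≠ 0 ∧ conj q.1 * q.2 + 1 ≠ 0} :=
    ⟨fun p _ => Gmap_leftInverse_Fmap p, fun q _ => Gmap_rightInverse_Fmap q⟩
  exact ⟨h.bijOn mapsTo_Fmap mapsTo_Gmap, h⟩
end

section
/- Let F : {(ξ,η) ∈ ℂ² : ξ ≠ 0, ξη̄+1 ≠ 0} → ℂ², F(ξ,η) = (μ₁,μ₂) with μ₁ = −η + 1/ξ̄ and μ₂ = 1/(η̄ + 1/ξ). Then the pullback under F of the real 2-form Ω_μ = −[(1+μ₁μ̄₂)^{−2} dμ₁∧dμ̄₂ + (1+μ̄₁μ₂)^{−2} dμ̄₁∧dμ₂] equals the real 2-form Ω = −(1/2)(dξ∧dη̄ + dξ̄∧dη). (Here ℂ² is regarded as ℝ⁴, and dμ₁, dμ̄₂, dξ, dη̄, etc. are the complex-valued 1-forms given by the differentials of the corresponding complex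 coordinate functions and their conjugates.) -/
open ComplexConjugate

/-- The 2-form `Ω_μ = −[(1+μ₁μ̄₂)⁻² dμ₁∧dμ̄₂ + (1+μ̄₁μ₂)⁻² dμ̄₁∧dμ₂]` at the point `q`,
evaluated on tangent vectors `a`, `b` of `ℂ² ≅ ℝ⁴`. -/
noncomputable def OmegaMu (q : ℂ × ℂ) (a b : ℂ × ℂ) : ℂ :=
  -(((1 + q.1 * conj q.2) ^ 2)⁻¹ * (a.1 * conj b.2 - b.1 * conj a.2)
    + ((1 + conj q.1 * q.2) ^ 2)⁻¹ * (conj a.1 * b.2 - conj b.1 * a.2))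

/-- The 2-form `Ω = −(1/2)(dξ∧dη̄ + dξ̄∧dη)` evaluated on tangent vectors `a`, `b`. -/
noncomputable def OmegaXiEta (a b : ℂ × ℂ) : ℂ :=
  -(1 / 2) * ((a.1 * conj b.2 - b.1 * conj a.2) + (conj a.1 * b.2 - conj b.1 * a.2))

/-- The real differential of `Fmap` at a point of its domain. -/
theorem fderiv_Fmap_apply {p : ℂ × ℂ} (h₁ : p.1 ≠ 0) (h₂ : conj p.2 + 1 / p.1 ≠ 0)
    (a : ℂ × ℂ) :
    fderiv ℝ Fmap p a =
      (-a.2 - conj a.1 / conj p.1 ^ 2,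
        -(conj a.2 - a.1 / p.1 ^ 2) / (conj p.2 + 1 / p.1) ^ 2) := by
  have hconj (z : ℂ) : HasFDerivAt (fun w : ℂ => conj w)
      (Complex.conjCLE : ℂ →L[ℝ] ℂ) z := Complex.conjCLE.hasFDerivAt
  have hinv {f : ℂ × ℂ → ℂ} {f' : ℂ × ℂ →L[ℝ] ℂ} (hf : HasFDerivAt f f' p) (h : f p ≠ 0) :
      HasFDerivAt (fun q => 1 / f q) (-(f p ^ 2)⁻¹ • f') p := by
    simpa only [one_div, Function.comp_def] using
      ((hasDerivAt_inv h).comp_hasFDerivAt_of_eq p hf rfl)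
  have hξ : HasFDerivAt (fun q : ℂ × ℂ => q.1) (ContinuousLinearMap.fst ℝ ℂ ℂ) p :=
    hasFDerivAt_fst
  have hη : HasFDerivAt (fun q : ℂ × ℂ => q.2) (ContinuousLinearMap.snd ℝ ℂ ℂ) p :=
    hasFDerivAt_snd
  have hF : HasFDerivAt Fmap _ p :=
    (hη.neg.add (hinv ((hconj p.1).comp p hξ) (by simpa using h₁))).prodMk
      (hinv (((hconj p.2).comp p hη).add (hinv hξ h₁)) h₂)
  rw [hF.fderiv]
  ext1
  · simp [div_eq_inv_mul, sub_eq_add_neg]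
  · simp [div_eq_inv_mul]
    ring

theorem one_add_neg_add_inv_mul_inv {K : Type*} [Field K] {z w : K} (hz : z ≠ 0)
    (h : z * w + 1 ≠ 0) : 1 + (-w + 1 / z) * (1 / (w + 1 / z)) = 2 / (z * w + 1) := by
  have hd : w + 1 / z = (z * w + 1) / z := by field_simp
  rw [hd, one_div_div, eq_div_iff h, add_mul, mul_assoc, div_mul_cancel₀ _ h]
  field_simp
  ring

theorem stmt_8 :
    ∀ p : ℂ × ℂ, p.1 ≠ 0 → p.1 * conj p.2 + 1 ≠ 0 →
      ∀ a b : ℂ × ℂ,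
        OmegaMu (Fmap p) (fderiv ℝ Fmap p a) (fderiv ℝ Fmap p b) = OmegaXiEta a b := by
  rintro ⟨ξ, η⟩ hξ hne ⟨a₁, a₂⟩ ⟨b₁, b₂⟩
  dsimp only at hξ hne
  have hξ' : conj ξ ≠ 0 := by simpa using hξ
  have hne' : conj ξ * η + 1 ≠ 0 := by simpa using (map_ne_zero conj).2 hne
  have hd : conj η + 1 / ξ = (ξ * conj η + 1) / ξ := by field_simp
  have hd' : η + 1 / conj ξ = (conj ξ * η + 1) / conj ξ := by field_simp
  have hd0 : conj η + 1 / ξ ≠ 0 := hd ▸ div_ne_zero hne hξ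
  rw [fderiv_Fmap_apply hξ hd0, fderiv_Fmap_apply hξ hd0]
  simp only [OmegaMu, OmegaXiEta, Fmap, map_add, map_sub, map_neg, map_div₀, map_pow, map_one,
    Complex.conj_conj]
  rw [one_add_neg_add_inv_mul_inv hξ' hne', one_add_neg_add_inv_mul_inv hξ hne, hd, hd']
  field_simp
  ring
end

section
/- Let α,β,γ ∈ ℂ with α,γ not both zero, let τ ∈ ℂ satisfy β = −γτ − ᾱτ², and set γ₁ = γ + 2ᾱτ; assume γ₁ ≠ 0. Fix t₀ > 0 and z₀ ∈ ℂ, set Λ = |z₀−τ|² + t₀², and define for s ∈ ℝ: D(s) = |z̄₀ − τ̄ − (ᾱ/γ₁)(e^{γ₁s}−1)Λ|² + t₀², t(s) = t₀ Λ e^{Re(γ₁)s} / D(s), and z(s) = [z₀ − τ − (α/γ̄₁)(e^{γ̄₁s}−1)Λ] Λ e^{γ₁s} / D(s) + τ. Then t(0) = t₀, z(0) = z₀, t(s) > 0 for all s, and (t(s), z(s)) solves the system of ODEs t′ = t·((γ+γ̄)/2 + αz̄ + ᾱz), z′ = β + γz − αt² + ᾱz² for all s ∈ ℝ. (These ODEs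 are the flow equations of the general Killing field of the hyperbolic metric.) -/
open ComplexConjugate

theorem hasDerivAt_cexp_mul_ofReal (c : ℂ) (s : ℝ) :
    HasDerivAt (fun u : ℝ => Complex.exp (c * (u : ℂ))) (c * Complex.exp (c * (s : ℂ))) s := by
  have h : HasDerivAt (fun u : ℝ => c * (u : ℂ)) c s := by
    simpa using (Complex.ofRealCLM.hasDerivAt (x := s)).const_mul c
  simpa [mul_comm] using h.cexp

theorem exp_re_mul_ofReal_sq (c : ℂ) (s : ℝ) :
    ((Real.exp (c.re * s) : ℝ) : ℂ) ^ 2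
      = Complex.exp (c * (s : ℂ)) * Complex.exp (conj c * (s : ℂ)) := by
  rw [Complex.ofReal_exp, ← Complex.exp_nat_mul, ← Complex.exp_add]
  congr 1
  push_cast
  rw [← add_mul, Complex.add_conj]
  push_cast
  ring

theorem stmt_12 (α β γ τ γ₁ : ℂ) (hαγ : ¬(α = 0 ∧ γ = 0))
    (hβ : β = -γ * τ - conj α * τ ^ 2)
    (hγ₁def : γ₁ = γ + 2 * conj α * τ) (hγ₁ : γ₁ ≠ 0)
    (t₀ : ℝ) (ht₀ : 0 < t₀) (z₀ : ℂ) :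
    let Λ : ℝ := Complex.normSq (z₀ - τ) + t₀ ^ 2
    let D : ℝ → ℝ := fun s =>
      Complex.normSq (conj z₀ - conj τ
        - (conj α / γ₁) * (Complex.exp (γ₁ * (s : ℂ)) - 1) * (Λ : ℂ)) + t₀ ^ 2
    let t : ℝ → ℝ := fun s => t₀ * Λ * Real.exp (γ₁.re * s) / D s
    let z : ℝ → ℂ := fun s =>
      (z₀ - τ - (α / conj γ₁) * (Complex.exp (conj γ₁ * (s : ℂ)) - 1) * (Λ : ℂ))
        * (Λ : ℂ) * Complex.exp (γ₁ * (s : ℂ)) / ((D s : ℝ) : ℂ) + τ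
    t 0 = t₀ ∧ z 0 = z₀ ∧ (∀ s : ℝ, 0 < t s) ∧
    ∀ s : ℝ,
      HasDerivAt (fun u => ((t u : ℝ) : ℂ))
        (((t s : ℝ) : ℂ) * ((γ + conj γ) / 2 + α * conj (z s) + conj α * z s)) s ∧
      HasDerivAt z (β + γ * z s - α * ((t s : ℝ) : ℂ) ^ 2 + conj α * (z s) ^ 2) s := by
  intro Λ D t z
  have hΛ : 0 < Λ := add_pos_of_nonneg_of_pos (Complex.normSq_nonneg _) (by positivity)
  have hD (s : ℝ) : 0 < D s :=
    add_pos_of_nonneg_of_pos (Complex.normSq_nonneg _) (by positivity)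
  have hγ₁' : conj γ₁ ≠ 0 := by simpa using hγ₁
  have hD0 : D 0 = Λ := by
    simp only [D, Λ, Complex.ofReal_zero, mul_zero, Complex.exp_zero, sub_self, zero_mul,
      sub_zero]
    rw [← map_sub, Complex.normSq_conj]
  refine ⟨?_, ?_, fun s => by have := hD s; positivity, fun s => ?_⟩
  · simp only [t, hD0, mul_zero, Real.exp_zero, mul_one]
    field_simp
  · have hΛ' : (Λ : ℂ) ≠ 0 := by exact_mod_cast hΛ.ne'
    simp only [z, hD0, Complex.ofReal_zero, mul_zero, Complex.exp_zero, sub_self, zero_mul,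
      sub_zero, mul_one]
    field_simp
    ring
  let E : ℝ → ℂ := fun u => Complex.exp (γ₁ * (u : ℂ))
  let F : ℝ → ℂ := fun u => Complex.exp (conj γ₁ * (u : ℂ))
  let P : ℝ → ℂ := fun u => z₀ - τ - (α / conj γ₁) * (F u - 1) * (Λ : ℂ)
  let Q : ℝ → ℂ := fun u => conj z₀ - conj τ - (conj α / γ₁) * (E u - 1) * (Λ : ℂ)
  let R : ℝ → ℂ := fun u => ((Real.exp (γ₁.re * u) : ℝ) : ℂ)
  have hEF (u : ℝ) : conj (E u) = F u := by
    simp [E, F, ← Complex.exp_conj]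
  have hFE (u : ℝ) : conj (F u) = E u := by
    rw [← hEF, Complex.conj_conj]
  have hPQ (u : ℝ) : conj (P u) = Q u := by
    simp [P, Q, hFE]
  have hDc (u : ℝ) : ((D u : ℝ) : ℂ) = Q u * P u + (t₀ : ℂ) ^ 2 := by
    have : D u = Complex.normSq (Q u) + t₀ ^ 2 := rfl
    rw [this, Complex.ofReal_add, Complex.normSq_eq_conj_mul_self, ← hPQ, Complex.conj_conj]
    push_cast
    ring
  have hDs : Q s * P s + (t₀ : ℂ) ^ 2 ≠ 0 := by
    rw [← hDc]
    exact_mod_cast (hD s).ne'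
  have htc (u : ℝ) : ((t u : ℝ) : ℂ) = t₀ * Λ * R u / (Q u * P u + (t₀ : ℂ) ^ 2) := by
    rw [← hDc]
    simp only [t, R]
    push_cast
    ring
  have hzc (u : ℝ) : z u = P u * Λ * E u / (Q u * P u + (t₀ : ℂ) ^ 2) + τ := by
    rw [← hDc]
  have hzs : conj (z s) = Q s * Λ * F s / (Q s * P s + (t₀ : ℂ) ^ 2) + conj τ := by
    have : conj (z s) = conj (P s * Λ * E s / ((D s : ℝ) : ℂ) + τ) := rfl
    rw [this, map_add, map_div₀, map_mul, map_mul, hPQ, hEF, Complex.conj_ofReal,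
      Complex.conj_ofReal, hDc]
  have hE : HasDerivAt E (γ₁ * E s) s := hasDerivAt_cexp_mul_ofReal γ₁ s
  have hF : HasDerivAt F (conj γ₁ * F s) s := hasDerivAt_cexp_mul_ofReal (conj γ₁) s
  have hP : HasDerivAt P (-(α * F s * Λ)) s := by
    refine ((((hF.sub_const 1).const_mul (α / conj γ₁)).mul_const (Λ : ℂ)).const_sub
      (z₀ - τ)).congr_deriv ?_
    field_simp
  have hQ : HasDerivAt Q (-(conj α * E s * Λ)) s := by
    refine ((((hE.sub_const 1).const_mul (conj α / γ₁)).mul_const (Λ : ℂ)).const_sub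
      (conj z₀ - conj τ)).congr_deriv ?_
    field_simp
  have hR : HasDerivAt R ((γ₁.re : ℂ) * R s) s := by
    simpa [R] using hasDerivAt_cexp_mul_ofReal (γ₁.re : ℂ) s
  have hR2 : R s ^ 2 = E s * F s := exp_re_mul_ofReal_sq γ₁ s
  have hre : (γ₁.re : ℂ) = (γ + conj γ) / 2 + α * conj τ + conj α * τ := by
    rw [Complex.re_eq_add_conj, hγ₁def]
    simp only [map_add, map_mul, Complex.conj_conj, map_ofNat]
    ring
  have hDd := (hQ.mul hP).add_const ((t₀ : ℂ) ^ 2)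
  clear_value t z D P Q R E F Λ
  constructor
  · rw [funext htc, htc s, hzs, hzc s]
    refine ((hR.const_mul ((t₀ : ℂ) * Λ)).div hDd hDs).congr_deriv ?_
    simp only [Pi.mul_apply]
    rw [hre]
    field_simp
    ring
  · rw [funext hzc, htc s, hβ]
    refine ((((hP.mul_const (Λ : ℂ)).mul hE).div hDd hDs).add_const τ).congr_deriv ?_
    simp only [Pi.mul_apply]
    rw [div_pow, mul_pow, hR2, hγ₁def]
    generalize hd : Q s * P s + (t₀ : ℂ) ^ 2 = d at hDs ⊢
    field_simp
    rw [← hd]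
    ring
end

section
/- Let b₁,b₂,b₃,b₄ ∈ ℂ with b₂ ≠ 0 and b₃ ≠ 0, and let I ⊂ ℝ be an interval on which sinh(b₂t+b₁) ≠ 0. Then the curves ξ(t) = b̄₃ sinh(b₂t+b₁)/b₂ and η(t) = b₄ − b̄₂ cosh(b̄₂t+b̄₁)/(b₃ sinh(b̄₂t+b̄₁)) satisfy, for all t ∈ I, the geodesic equations of the neutral Kähler metric 𝔾: ξξ̈ − ξ̇² + (conj(η̇))²ξ⁴ = 0 and conj(ξ)·η̈ + 2·conj(ξ̇)·η̇ = 0. -/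
open ComplexConjugate

theorem hasDerivAt_linear_ofReal (a c : ℂ) (t : ℝ) :
    HasDerivAt (fun t : ℝ => a * (t : ℂ) + c) a t := by
  simpa using ((Complex.ofRealCLM.hasDerivAt (x := t)).const_mul a).add_const c

theorem hasDerivAt_sinh_linear (a c : ℂ) (t : ℝ) :
    HasDerivAt (fun t : ℝ => Complex.sinh (a * (t : ℂ) + c))
      (Complex.cosh (a * (t : ℂ) + c) * a) t :=
  (Complex.hasDerivAt_sinh _).comp t (hasDerivAt_linear_ofReal a c t)

theorem hasDerivAt_cosh_linear (a c : ℂ) (t : ℝ) :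
    HasDerivAt (fun t : ℝ => Complex.cosh (a * (t : ℂ) + c))
      (Complex.sinh (a * (t : ℂ) + c) * a) t :=
  (Complex.hasDerivAt_cosh _).comp t (hasDerivAt_linear_ofReal a c t)

theorem stmt_14 (b₁ b₂ b₃ b₄ : ℂ) (hb₂ : b₂ ≠ 0) (hb₃ : b₃ ≠ 0)
    (I : Set ℝ) (hI : I.OrdConnected)
    (hsinh : ∀ t ∈ I, Complex.sinh (b₂ * (t : ℂ) + b₁) ≠ 0) :
    let ξ : ℝ → ℂ := fun t => conj b₃ * Complex.sinh (b₂ * (t : ℂ) + b₁) / b₂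
    let η : ℝ → ℂ := fun t => b₄ - conj b₂ * Complex.cosh (conj b₂ * (t : ℂ) + conj b₁) /
      (b₃ * Complex.sinh (conj b₂ * (t : ℂ) + conj b₁))
    ∀ t ∈ I,
      ξ t * deriv (deriv ξ) t - (deriv ξ t) ^ 2 + (conj (deriv η t)) ^ 2 * (ξ t) ^ 4 = 0 ∧
      conj (ξ t) * deriv (deriv η) t + 2 * conj (deriv ξ t) * deriv η t = 0 := by
  intro ξ η t ht
  have ha : conj b₂ ≠ 0 := (map_ne_zero _).2 hb₂
  have hd : conj b₃ ≠ 0 := (map_ne_zero _).2 hb₃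
  have hs := hsinh t ht
  have conj_sinh : ∀ u : ℝ, conj (Complex.sinh (b₂ * (u : ℂ) + b₁)) =
      Complex.sinh (conj b₂ * (u : ℂ) + conj b₁) := fun u => by
    rw [← Complex.sinh_conj]; simp
  have conj_cosh : ∀ u : ℝ, conj (Complex.cosh (b₂ * (u : ℂ) + b₁)) =
      Complex.cosh (conj b₂ * (u : ℂ) + conj b₁) := fun u => by
    rw [← Complex.cosh_conj]; simp
  have hS : Complex.sinh (conj b₂ * (t : ℂ) + conj b₁) ≠ 0 := by
    rw [← conj_sinh]; exact (map_ne_zero _).2 hs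
  have hξ : deriv ξ = fun u : ℝ => conj b₃ * Complex.cosh (b₂ * (u : ℂ) + b₁) := by
    funext u
    refine ((((hasDerivAt_sinh_linear b₂ b₁ u).const_mul (conj b₃)).div_const b₂).deriv).trans ?_
    field_simp
  have hξ' : deriv (deriv ξ) t = conj b₃ * (Complex.sinh (b₂ * (t : ℂ) + b₁) * b₂) := by
    rw [hξ]
    exact ((hasDerivAt_cosh_linear b₂ b₁ t).const_mul (conj b₃)).deriv
  have hη : ∀ u : ℝ, Complex.sinh (conj b₂ * (u : ℂ) + conj b₁) ≠ 0 →
      deriv η u = conj b₂ ^ 2 / (b₃ * Complex.sinh (conj b₂ * (u : ℂ) + conj b₁) ^ 2) := by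
    intro u hu
    refine (((((hasDerivAt_cosh_linear (conj b₂) (conj b₁) u).const_mul (conj b₂)).div
      ((hasDerivAt_sinh_linear (conj b₂) (conj b₁) u).const_mul b₃)
      (mul_ne_zero hb₃ hu)).const_sub b₄).deriv).trans ?_
    have h := Complex.cosh_sq (conj b₂ * (u : ℂ) + conj b₁)
    field_simp
    linear_combination h
  have hη' : deriv (deriv η) t = -2 * conj b₂ ^ 3 * Complex.cosh (conj b₂ * (t : ℂ) + conj b₁) /
      (b₃ * Complex.sinh (conj b₂ * (t : ℂ) + conj b₁) ^ 3) := by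
    have hev : deriv η =ᶠ[nhds t] fun u : ℝ =>
        conj b₂ ^ 2 / (b₃ * Complex.sinh (conj b₂ * (u : ℂ) + conj b₁) ^ 2) :=
      ((hasDerivAt_sinh_linear (conj b₂) (conj b₁) t).continuousAt.eventually_ne hS).mono hη
    rw [hev.deriv_eq]
    refine (((hasDerivAt_const t (conj b₂ ^ 2)).div
      (((hasDerivAt_sinh_linear (conj b₂) (conj b₁) t).pow 2).const_mul b₃)
      (mul_ne_zero hb₃ (pow_ne_zero 2 hS))).deriv).trans ?_
    simp only [Pi.pow_apply]
    field_simp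
    ring
  rw [hξ', hη', hη t hS, hξ]
  simp only [ξ, map_div₀, map_mul, map_pow, Complex.conj_conj, conj_cosh, conj_sinh]
  rw [← conj_sinh, Complex.conj_conj]
  constructor
  · have h := Complex.cosh_sq (b₂ * (t : ℂ) + b₁)
    field_simp
    linear_combination -conj b₃ ^ 2 * h
  · rw [conj_sinh]
    field_simp
    ring
end

section
/- Let (ξ,η) : I → (ℂ∖{0}) × ℂ be a C² solution of the geodesic equations of the neutral Kähler metric 𝔾 on an interval I: ξξ̈ − ξ̇² + (conj(η̇))²ξ⁴ = 0 and conj(ξ)·η̈ + 2·conj(ξ̇)·η̇ = 0. Then the quantity conj(ξ(t))²·η̇(t) is constant on I; and writing b₃ for this constant value (so that η̇ = b₃/conj(ξ)²), the function ξ satisfies the scalar ODE ξξ̈ − ξ̇² + conj(b₃)² = 0 on I. -/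
open ComplexConjugate

/-- A function with vanishing derivative on an order-connected set of reals is constant there. -/
theorem eq_of_hasDerivAt_zero_of_ordConnected {E : Type*} [NormedAddCommGroup E]
    [NormedSpace ℝ E] {I : Set ℝ} (hI : I.OrdConnected) {f : ℝ → E}
    (hf : ∀ t ∈ I, HasDerivAt f 0 t) {s t : ℝ} (hs : s ∈ I) (ht : t ∈ I) : f t = f s := by
  have h := hI.convex.norm_image_sub_le_of_norm_hasDerivWithin_le (C := 0)
    (fun x hx => (hf x hx).hasDerivWithinAt) (by simp) hs ht
  rw [zero_mul] at h
  exact sub_eq_zero.mp (norm_le_zero_iff.mp h)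

theorem stmt_15 (I : Set ℝ) (hI : I.OrdConnected)
    (ξ η ξ' η' ξ'' η'' : ℝ → ℂ)
    (hξd : ∀ t ∈ I, HasDerivAt ξ (ξ' t) t)
    (hηd : ∀ t ∈ I, HasDerivAt η (η' t) t)
    (hξdd : ∀ t ∈ I, HasDerivAt ξ' (ξ'' t) t)
    (hηdd : ∀ t ∈ I, HasDerivAt η' (η'' t) t)
    (hne : ∀ t ∈ I, ξ t ≠ 0)
    (hgeo : ∀ t ∈ I,
      ξ t * ξ'' t - (ξ' t) ^ 2 + (conj (η' t)) ^ 2 * (ξ t) ^ 4 = 0 ∧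
      conj (ξ t) * η'' t + 2 * conj (ξ' t) * η' t = 0) :
    (∀ t ∈ I, ∀ s ∈ I, (conj (ξ t)) ^ 2 * η' t = (conj (ξ s)) ^ 2 * η' s) ∧
    ∀ b₃ : ℂ, (∀ t ∈ I, (conj (ξ t)) ^ 2 * η' t = b₃) →
      ∀ t ∈ I, ξ t * ξ'' t - (ξ' t) ^ 2 + (conj b₃) ^ 2 = 0 := by
  constructor
  · intro t ht s hs
    refine eq_of_hasDerivAt_zero_of_ordConnected hI
      (f := fun t => (conj (ξ t)) ^ 2 * η' t) (fun t ht => ?_) hs ht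
    have hconj : HasDerivAt (fun t => conj (ξ t)) (conj (ξ' t)) t := (hξd t ht).star
    refine ((hconj.pow 2).mul (hηdd t ht)).congr_deriv ?_
    simp only [Pi.pow_apply]
    push_cast
    linear_combination conj (ξ t) * (hgeo t ht).2
  · intro b₃ hb t ht
    rw [← hb t ht]
    simp only [map_mul, map_pow, Complex.conj_conj]
    linear_combination (hgeo t ht).1
end

section
/- Let b₁,b₂,b₃,b₄ ∈ ℂ with b₂ ≠ 0 and b₃ ≠ 0, and on an interval where sinh(b₂t+b₁) ≠ 0 define ξ(t) = b̄₃ sinh(b₂t+b₁)/b₂ and η(t) = b₄ − b̄₂ cosh(b̄₂t+b̄₁)/(b₃ sinh(b̄₂t+b̄₁)). Then the 𝔾-length squared of the tangent vector, namely −(i/4)[(ξ̇/ξ)² − (conj(ξ̇)/conj(ξ))² + conj(ξ)²·η̇² − ξ²·(conj(η̇))²], is constant in t and equals i(conj(b₂)² − b₂²)/4. In particular the geodesic of 𝔾 is null if and only if b₂² = conj(b₂)², i.e. iff b₂ is real or purely imaginary. -/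
open ComplexConjugate

lemma hasDerivAt_mul_ofReal_add (a b : ℂ) (t : ℝ) :
    HasDerivAt (fun s : ℝ => a * (s : ℂ) + b) a t := by
  simpa using ((Complex.ofRealCLM.hasDerivAt (x := t)).const_mul a).add_const b

lemma hasDerivAt_sinh_mul_ofReal_add (a b : ℂ) (t : ℝ) :
    HasDerivAt (fun s : ℝ => Complex.sinh (a * (s : ℂ) + b))
      (Complex.cosh (a * (t : ℂ) + b) * a) t :=
  (Complex.hasDerivAt_sinh _).comp t (hasDerivAt_mul_ofReal_add a b t)

lemma hasDerivAt_cosh_mul_ofReal_add (a b : ℂ) (t : ℝ) :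
    HasDerivAt (fun s : ℝ => Complex.cosh (a * (s : ℂ) + b))
      (Complex.sinh (a * (t : ℂ) + b) * a) t :=
  (Complex.hasDerivAt_cosh _).comp t (hasDerivAt_mul_ofReal_add a b t)

lemma hasDerivAt_sub_coth_mul_ofReal_add (a b c d : ℂ) (hc : c ≠ 0) (t : ℝ)
    (h : Complex.sinh (a * (t : ℂ) + b) ≠ 0) :
    HasDerivAt (fun s : ℝ => d - a * Complex.cosh (a * (s : ℂ) + b) /
      (c * Complex.sinh (a * (s : ℂ) + b)))
      (a ^ 2 / (c * Complex.sinh (a * (t : ℂ) + b) ^ 2)) t := by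
  have key := (((hasDerivAt_cosh_mul_ofReal_add a b t).const_mul a).fun_div
    ((hasDerivAt_sinh_mul_ofReal_add a b t).const_mul c) (mul_ne_zero hc h)).const_sub d
  refine key.congr_deriv ?_
  have hcs := Complex.cosh_sq (a * (t : ℂ) + b)
  generalize Complex.sinh (a * (t : ℂ) + b) = S at *
  generalize Complex.cosh (a * (t : ℂ) + b) = C at *
  field_simp
  linear_combination a ^ 2 * hcs

theorem stmt_16 (b₁ b₂ b₃ b₄ : ℂ) (hb₂ : b₂ ≠ 0) (hb₃ : b₃ ≠ 0)
    (I : Set ℝ) (hI : I.OrdConnected)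
    (hsinh : ∀ t ∈ I, Complex.sinh (b₂ * (t : ℂ) + b₁) ≠ 0) :
    let ξ : ℝ → ℂ := fun t => conj b₃ * Complex.sinh (b₂ * (t : ℂ) + b₁) / b₂
    let η : ℝ → ℂ := fun t => b₄ - conj b₂ * Complex.cosh (conj b₂ * (t : ℂ) + conj b₁) /
      (b₃ * Complex.sinh (conj b₂ * (t : ℂ) + conj b₁))
    (∀ t ∈ I,
      -(Complex.I / 4) * ((deriv ξ t / ξ t) ^ 2 - (conj (deriv ξ t) / conj (ξ t)) ^ 2
          + (conj (ξ t)) ^ 2 * (deriv η t) ^ 2 - (ξ t) ^ 2 * (conj (deriv η t)) ^ 2)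
        = Complex.I * ((conj b₂) ^ 2 - b₂ ^ 2) / 4) ∧
    (Complex.I * ((conj b₂) ^ 2 - b₂ ^ 2) / 4 = 0 ↔ b₂ ^ 2 = (conj b₂) ^ 2) ∧
    (b₂ ^ 2 = (conj b₂) ^ 2 ↔ (b₂.im = 0 ∨ b₂.re = 0)) := by
  intro ξ η
  refine ⟨fun t ht => ?_, ?_, ?_⟩
  · have hS := hsinh t ht
    have hconj : conj b₂ * (t : ℂ) + conj b₁ = conj (b₂ * (t : ℂ) + b₁) := by simp
    have hS' : Complex.sinh (conj b₂ * (t : ℂ) + conj b₁) ≠ 0 := by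
      rw [hconj, Complex.sinh_conj]
      exact (map_ne_zero _).2 hS
    have hξ : deriv ξ t = conj b₃ * (Complex.cosh (b₂ * (t : ℂ) + b₁) * b₂) / b₂ :=
      (((hasDerivAt_sinh_mul_ofReal_add b₂ b₁ t).const_mul (conj b₃)).div_const b₂).deriv
    have hη := (hasDerivAt_sub_coth_mul_ofReal_add (conj b₂) (conj b₁) b₃ b₄ hb₃ t hS').deriv
    change deriv η t = _ at hη
    have hb₂' : conj b₂ ≠ 0 := (map_ne_zero _).2 hb₂
    have hb₃' : conj b₃ ≠ 0 := (map_ne_zero _).2 hb₃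
    rw [hconj, Complex.sinh_conj] at hη
    have hcs := Complex.cosh_sq (b₂ * (t : ℂ) + b₁)
    have hcs' := congrArg conj hcs
    rw [hξ, hη]
    simp only [ξ]
    generalize Complex.sinh (b₂ * (t : ℂ) + b₁) = S at *
    generalize Complex.cosh (b₂ * (t : ℂ) + b₁) = C at *
    have hS₂ : conj S ≠ 0 := (map_ne_zero _).2 hS
    simp only [map_mul, map_div₀, map_pow, Complex.conj_conj, map_add, map_one] at hcs' ⊢
    field_simp
    rw [hcs, hcs']
    ring
  · rw [div_eq_zero_iff, mul_eq_zero, sub_eq_zero]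
    simp [eq_comm]
  · rw [sq_eq_sq_iff_eq_or_eq_neg]
    simp only [Complex.ext_iff, Complex.conj_re, Complex.conj_im, Complex.neg_re, Complex.neg_im,
      neg_neg, true_and, and_true, self_eq_neg]
end

section
/- Let b₁,b₂,b₃,b₄ ∈ ℂ with b₂ ≠ 0 and b₃ ≠ 0, and set c₁ = −(b₃²b₄² − b̄₂²)/(2b₃), c₂ = −b₃b₄, c₃ = −b₃/2. On any interval where the denominators below are nonzero, define μ₁(t) = −b₄ + b̄₂[1 + cosh(b̄₂t+b̄₁)]/(b₃ sinh(b̄₂t+b̄₁)) and μ₂(t) = b̄₃ sinh(b₂t+b₁)/(b̄₃b̄₄ sinh(b₂t+b₁) + b₂[1 − cosh(b₂t+b₁)]). Then for all t in that interval: μ̇₁(t) = c₁ + c₂μ₁(t) + c₃μ₁(t)² and μ̇₂(t) = c̄₃ − c̄₂μ₂(t) + c̄₁μ₂(t)². (Thus the tangent vector along a geodesic of the neutral Kähler metric 𝔾 is the restriction of a Killing field of 𝔾, so the geodesics of 𝔾 are generated by 1-parameter subgroups of its isometry group.) -/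
open ComplexConjugate

theorem hasDerivAt_affine_ofReal (a b : ℂ) (t : ℝ) :
    HasDerivAt (fun x : ℝ => a * (x : ℂ) + b) a t := by
  simpa using ((Complex.ofRealCLM.hasDerivAt (x := t)).const_mul a).add_const b

theorem hasDerivAt_sinh_affine_ofReal (a b : ℂ) (t : ℝ) :
    HasDerivAt (fun x : ℝ => Complex.sinh (a * (x : ℂ) + b))
      (Complex.cosh (a * (t : ℂ) + b) * a) t :=
  (Complex.hasDerivAt_sinh _).comp t (hasDerivAt_affine_ofReal a b t)

theorem hasDerivAt_cosh_affine_ofReal (a b : ℂ) (t : ℝ) :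
    HasDerivAt (fun x : ℝ => Complex.cosh (a * (x : ℂ) + b))
      (Complex.sinh (a * (t : ℂ) + b) * a) t :=
  (Complex.hasDerivAt_cosh _).comp t (hasDerivAt_affine_ofReal a b t)

theorem stmt_17 (b₁ b₂ b₃ b₄ : ℂ) (hb₂ : b₂ ≠ 0) (hb₃ : b₃ ≠ 0) (I : Set ℝ) :
    let c₁ : ℂ := -(b₃ ^ 2 * b₄ ^ 2 - (conj b₂) ^ 2) / (2 * b₃)
    let c₂ : ℂ := -(b₃ * b₄)
    let c₃ : ℂ := -(b₃ / 2)
    let μ₁ : ℝ → ℂ := fun t => -b₄ +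
      conj b₂ * (1 + Complex.cosh (conj b₂ * (t : ℂ) + conj b₁)) /
        (b₃ * Complex.sinh (conj b₂ * (t : ℂ) + conj b₁))
    let μ₂ : ℝ → ℂ := fun t =>
      conj b₃ * Complex.sinh (b₂ * (t : ℂ) + b₁) /
        (conj b₃ * conj b₄ * Complex.sinh (b₂ * (t : ℂ) + b₁)
          + b₂ * (1 - Complex.cosh (b₂ * (t : ℂ) + b₁)))
    (∀ t ∈ I, b₃ * Complex.sinh (conj b₂ * (t : ℂ) + conj b₁) ≠ 0) →
    (∀ t ∈ I, conj b₃ * conj b₄ * Complex.sinh (b₂ * (t : ℂ) + b₁)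
        + b₂ * (1 - Complex.cosh (b₂ * (t : ℂ) + b₁)) ≠ 0) →
    ∀ t ∈ I,
      deriv μ₁ t = c₁ + c₂ * μ₁ t + c₃ * (μ₁ t) ^ 2 ∧
      deriv μ₂ t = conj c₃ - conj c₂ * μ₂ t + conj c₁ * (μ₂ t) ^ 2 := by
  intro c₁ c₂ c₃ μ₁ μ₂ h₁ h₂ t ht
  have hd₁ := h₁ t ht
  have hd₂ := h₂ t ht
  have hb₃' : conj b₃ ≠ 0 := by simpa using hb₃
  constructor
  · have hμ : HasDerivAt μ₁ _ t :=
      ((((hasDerivAt_cosh_affine_ofReal (conj b₂) (conj b₁) t).const_add 1).const_mul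
        (conj b₂)).fun_div ((hasDerivAt_sinh_affine_ofReal (conj b₂) (conj b₁) t).const_mul b₃)
        hd₁).const_add (-b₄)
    rw [hμ.deriv]
    simp only [c₁, c₂, c₃, μ₁]
    have hcs := Complex.cosh_sq (conj b₂ * (t : ℂ) + conj b₁)
    have hs := right_ne_zero_of_mul hd₁
    generalize Complex.sinh (conj b₂ * (t : ℂ) + conj b₁) = s at *
    generalize Complex.cosh (conj b₂ * (t : ℂ) + conj b₁) = c at *
    field_simp
    linear_combination (-(conj b₂) ^ 2) * hcs
  · have hμ : HasDerivAt μ₂ _ t :=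
      ((hasDerivAt_sinh_affine_ofReal b₂ b₁ t).const_mul (conj b₃)).fun_div
        (((hasDerivAt_sinh_affine_ofReal b₂ b₁ t).const_mul (conj b₃ * conj b₄)).add
          (((hasDerivAt_cosh_affine_ofReal b₂ b₁ t).const_sub 1).const_mul b₂)) hd₂
    rw [hμ.deriv]
    simp only [c₁, c₂, c₃, μ₂, map_neg, map_div₀, map_mul, map_sub, map_pow, Complex.conj_conj,
      map_ofNat]
    have hcs := Complex.cosh_sq (b₂ * (t : ℂ) + b₁)
    generalize Complex.sinh (b₂ * (t : ℂ) + b₁) = s at *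
    generalize Complex.cosh (b₂ * (t : ℂ) + b₁) = c at *
    generalize conj b₃ = B₃ at *
    generalize conj b₄ = B₄ at *
    obtain ⟨D, hD⟩ : ∃ D, D = B₃ * B₄ * s + b₂ * (1 - c) := ⟨_, rfl⟩
    rw [← hD] at hd₂ ⊢
    field_simp
    subst hD
    linear_combination (-b₂ ^ 2) * hcs
end
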